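/- Let V be a finite-dimensional real vector space, p and q Hilbertian seminorms on V with tr(p/q) < ∞, and μ a Borel probability measure on the dual space V′ of all linear functionals on V. Let ε > 0 and δ > 0 be such that μ({ℓ ∈ V′ : |ℓ(v)| ≥ 1}) ≤ ε for all v ∈ V with p(v) ≤ δ. Then μ({ℓ ∈ V′ : |ℓ(v)| ≤ q(v) for all v ∈ V}) ≥ 1 − 7(ε + δ⁻² tr(p/q)). -/

import Mathlib

open MeasureTheory
open scoped ENNReal

noncomputable section

/-- The character space `X(A)` of a unital commutative `ℝ`-algebra `A`:
the set of `ℝ`-algebra homomorphisms `A → ℝ`. -/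
abbrev Character (A : Type*) [CommRing A] [Algebra ℝ A] := A →ₐ[ℝ] ℝ

/-- The weak topology on the character space: the weakest topology making all
evaluations `α ↦ α a` continuous. -/
instance Character.instTopologicalSpace (A : Type*) [CommRing A] [Algebra ℝ A] :
    TopologicalSpace (Character A) :=
  TopologicalSpace.induced (fun (α : Character A) (a : A) => α a) inferInstance

/-- The Borel σ-algebra on the character space. -/
instance Character.instMeasurableSpace (A : Type*) [CommRing A] [Algebra ℝ A] :
    MeasurableSpace (Character A) :=
  borel (Character A)

/-- A Radon measure: a locally finite Borel measure that is inner regular with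
respect to compact sets. -/
def IsRadonMeasure {X : Type*} [TopologicalSpace X] [MeasurableSpace X]
    (μ : Measure X) : Prop :=
  IsLocallyFiniteMeasure μ ∧ μ.InnerRegularWRT IsCompact MeasurableSet

/-- A Hilbertian seminorm on a real vector space `V`: a seminorm induced by a
symmetric positive semidefinite bilinear form, recorded by the form itself. -/
structure HilbSeminorm (V : Type*) [AddCommGroup V] [Module ℝ V] where
  bilin : V →ₗ[ℝ] V →ₗ[ℝ] ℝ
  symm : ∀ v w, bilin v w = bilin w v
  nonneg : ∀ v, 0 ≤ bilin v v

namespace HilbSeminorm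

variable {V W : Type*} [AddCommGroup V] [Module ℝ V] [AddCommGroup W] [Module ℝ W]

/-- The seminorm associated to a Hilbertian seminorm: `p v = √⟨v,v⟩ₚ`. -/
def toFun (p : HilbSeminorm V) (v : V) : ℝ := Real.sqrt (p.bilin v v)

/-- Pullback of a Hilbertian seminorm along a linear map (e.g. restriction to a
subspace along the inclusion). -/
def comp (p : HilbSeminorm V) (f : W →ₗ[ℝ] V) : HilbSeminorm W where
  bilin := LinearMap.compl₁₂ p.bilin f f
  symm v w := by
    simp only [LinearMap.compl₁₂_apply]
    exact p.symm (f v) (f w)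
  nonneg v := by
    simp only [LinearMap.compl₁₂_apply]
    exact p.nonneg (f v)

/-- The Hilbertian seminorm `c • p`, induced by the bilinear form `c² ⟨·,·⟩ₚ`. -/
def smul (p : HilbSeminorm V) (c : ℝ) : HilbSeminorm V where
  bilin := c ^ 2 • p.bilin
  symm v w := by
    simp only [LinearMap.smul_apply, smul_eq_mul]
    rw [p.symm v w]
  nonneg v := by
    simp only [LinearMap.smul_apply, smul_eq_mul]
    exact mul_nonneg (sq_nonneg c) (p.nonneg v)

/-- A finite subset `E ⊆ V` is `q`-orthonormal. -/
def IsONS (q : HilbSeminorm V) (E : Finset V) : Prop :=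
  (∀ e ∈ E, q.bilin e e = 1) ∧ ∀ e ∈ E, ∀ f ∈ E, e ≠ f → q.bilin e f = 0

open scoped Classical

/-- The trace `tr(p/q)` of a Hilbertian seminorm `p` with respect to a Hilbertian
seminorm `q`: the supremum over finite `q`-orthonormal sets `E` of `∑_{e∈E} p(e)²`
if `ker q ⊆ ker p`, and `∞` otherwise. -/
def trace (p q : HilbSeminorm V) : ℝ≥0∞ :=
  if ∀ v, q.bilin v v = 0 → p.bilin v v = 0 then
    ⨆ (E : Finset V) (_ : q.IsONS E), ENNReal.ofReal (∑ e ∈ E, p.bilin e e)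
  else ⊤

end HilbSeminorm

section AlgebraDefs

variable {A : Type*} [CommRing A] [Algebra ℝ A]

/-- The restriction `α|_V` of a character `α` is `q`-continuous. -/
def QContOn (V : Submodule ℝ A) (q : ↥V → ℝ) (α : Character A) : Prop :=
  ∃ C > 0, ∀ v : V, |α (v : A)| ≤ C * q v

/-- `J`: the family of all subalgebras of `A` generated by finite-dimensional
subspaces of `V`. -/
def finGenSubalgebras (V : Submodule ℝ A) : Set (Subalgebra ℝ A) :=
  {S | ∃ W : Submodule ℝ A, W ≤ V ∧ FiniteDimensional ℝ ↥W ∧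
    S = Algebra.adjoin ℝ (W : Set A)}

/-- The family `{ν_S : S ∈ J}` is `p`-concentrated. -/
def Concentrated (V : Submodule ℝ A) (J : Set (Subalgebra ℝ A)) (p : ↥V → ℝ)
    (ν : ∀ S : Subalgebra ℝ A, Measure (Character ↥S)) : Prop :=
  ∀ ε > (0 : ℝ), ∃ δ > (0 : ℝ), ∀ S ∈ J, ∀ v : V, ∀ hv : (v : A) ∈ S,
    p v ≤ δ → ν S {α : Character ↥S | 1 ≤ |α ⟨(v : A), hv⟩|} ≤ ENNReal.ofReal ε

/-- A quadratic module in `A`. -/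
def IsQuadraticModule (Q : Set A) : Prop :=
  (1 : A) ∈ Q ∧ (∀ x ∈ Q, ∀ y ∈ Q, x + y ∈ Q) ∧ ∀ a : A, ∀ x ∈ Q, a ^ 2 * x ∈ Q

/-- The nonnegativity set `K_Q ⊆ X(A)` of a quadratic module `Q`. -/
def charNonneg (Q : Set A) : Set (Character A) := {α | ∀ a ∈ Q, 0 ≤ α a}

/-- The nonnegativity set `K_{Q ∩ S} ⊆ X(S)` for a subalgebra `S`. -/
def charNonnegOn (Q : Set A) (S : Subalgebra ℝ A) : Set (Character ↥S) :=
  {α | ∀ a : S, (a : A) ∈ Q → 0 ≤ α a}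

/-- The Hilbertian seminorm `s_L(a) = √(L(a²))` induced by a `∑A²`-positive
linear functional `L`, via the bilinear form `(a,b) ↦ L(ab)`. -/
def sLSeminorm (L : A →ₗ[ℝ] ℝ) (hL : ∀ a : A, 0 ≤ L (a * a)) : HilbSeminorm A where
  bilin := (LinearMap.mul ℝ A).compr₂ L
  symm v w := by simp [mul_comm]
  nonneg v := by simpa using hL v

end AlgebraDefs

/-- `τ` is the topology induced by a directed family `P` of Hilbertian
seminorms. -/
def InducedByHilbFamily {V : Type*} [AddCommGroup V] [Module ℝ V]
    (τ : TopologicalSpace V) (P : Set (HilbSeminorm V)) : Prop :=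
  (∀ p ∈ P, ∀ q ∈ P, ∃ r ∈ P, ∀ v, p.toFun v ≤ r.toFun v ∧ q.toFun v ≤ r.toFun v) ∧
  ∀ v : V, (@nhds V τ v).HasBasis
    (fun pe : HilbSeminorm V × ℝ => pe.1 ∈ P ∧ 0 < pe.2)
    (fun pe => {w | pe.1.toFun (w - v) < pe.2})

/-- A topology is nuclear (in the sense of Yamasaki) if it is induced by a
directed family `P` of Hilbertian seminorms such that every `p ∈ P` admits
`q ∈ P` with `tr(p/q) < ∞`. -/
def IsNuclearTopology {V : Type*} [AddCommGroup V] [Module ℝ V]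
    (τ : TopologicalSpace V) : Prop :=
  ∃ P : Set (HilbSeminorm V), InducedByHilbFamily τ P ∧
    ∀ p ∈ P, ∃ q ∈ P, p.trace q < ⊤

end
section GaussianBounds

open ProbabilityTheory Real
open scoped NNReal

lemma gaussianReal_Ioo_le {v : ℝ≥0} (hv : 1 ≤ v) :
    gaussianReal 0 v (Set.Ioo (-1) 1) ≤ ENNReal.ofReal (6 / 7) := by
  have hv1 : (1 : ℝ) ≤ v := by exact_mod_cast hv
  have hpdf (x : ℝ) : gaussianPDF 0 v x ≤ ENNReal.ofReal (3 / 7) := by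
    refine ENNReal.ofReal_le_ofReal ?_
    have hsqrt : (7 / 3 : ℝ) ≤ √(2 * π * v) := by
      refine Real.le_sqrt_of_sq_le ?_
      nlinarith [Real.pi_gt_three]
    have hinv : (√(2 * π * v))⁻¹ ≤ 3 / 7 := by
      simpa using inv_anti₀ (by norm_num) hsqrt
    have hexp : rexp (-(x - 0) ^ 2 / (2 * v)) ≤ 1 := by
      rw [Real.exp_le_one_iff, neg_div]
      exact neg_nonpos.2 (by positivity)
    calc gaussianPDFReal 0 v x ≤ 3 / 7 * 1 :=
          mul_le_mul hinv hexp (Real.exp_pos _).le (by norm_num)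
      _ = 3 / 7 := mul_one _
  rw [gaussianReal_apply 0 (by positivity)]
  calc ∫⁻ x in Set.Ioo (-1) 1, gaussianPDF 0 v x
      ≤ ∫⁻ _ in Set.Ioo (-1 : ℝ) 1, ENNReal.ofReal (3 / 7) := lintegral_mono hpdf
    _ = ENNReal.ofReal (6 / 7) := by
        rw [setLIntegral_const, Real.volume_Ioo, ← ENNReal.ofReal_mul (by norm_num)]
        norm_num

lemma one_le_seven_mul_gaussianReal {v : ℝ≥0} (hv : 1 ≤ v) :
    1 ≤ 7 * gaussianReal 0 v {x | 1 ≤ |x|} := by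
  have hset : {x : ℝ | 1 ≤ |x|} = (Set.Ioo (-1) 1)ᶜ := by
    ext x
    simp [← abs_lt]
  rw [hset, prob_compl_eq_one_sub measurableSet_Ioo]
  calc (1 : ℝ≥0∞) = 7 * (1 - ENNReal.ofReal (6 / 7)) := by
        rw [← ENNReal.ofReal_one, ← ENNReal.ofReal_sub _ (by norm_num),
          ← ENNReal.ofReal_ofNat, ← ENNReal.ofReal_mul (by norm_num)]
        norm_num
    _ ≤ _ := by gcongr; exact gaussianReal_Ioo_le hv

variable {ι : Type*} [Fintype ι]

lemma stdGaussian_map_sum_mul (a : ι → ℝ) :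
    (stdGaussian (EuclideanSpace ℝ ι)).map (fun x ↦ ∑ i, x i * a i) =
      gaussianReal 0 (∑ i, a i ^ 2).toNNReal := by
  have hfun : (fun x : EuclideanSpace ℝ ι ↦ ∑ i, x i * a i) =
      innerSL ℝ (WithLp.toLp 2 a : EuclideanSpace ℝ ι) := by
    ext x
    simp [PiLp.inner_apply]
  rw [hfun, IsGaussian.map_eq_gaussianReal, integral_strongDual_stdGaussian,
    variance_dual_stdGaussian, innerSL_apply_norm, EuclideanSpace.norm_sq_eq]
  simp

lemma one_le_seven_mul_stdGaussian {a : ι → ℝ} (ha : 1 ≤ ∑ i, a i ^ 2) :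
    1 ≤ 7 * stdGaussian (EuclideanSpace ℝ ι) {x | 1 ≤ |∑ i, x i * a i|} := by
  have hmap : stdGaussian (EuclideanSpace ℝ ι) {x | 1 ≤ |∑ i, x i * a i|} =
      gaussianReal 0 (∑ i, a i ^ 2).toNNReal {y | 1 ≤ |y|} := by
    rw [← stdGaussian_map_sum_mul, Measure.map_apply (by fun_prop)
      (measurableSet_le (by fun_prop) (by fun_prop))]
    rfl
  rw [hmap]
  exact one_le_seven_mul_gaussianReal (by simpa using Real.toNNReal_le_toNNReal ha)

lemma memLp_two_eval_stdGaussian (i : ι) :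
    MemLp (fun x : EuclideanSpace ℝ ι ↦ x i) 2 (stdGaussian (EuclideanSpace ℝ ι)) :=
  IsGaussian.memLp_dual (stdGaussian (EuclideanSpace ℝ ι)) (EuclideanSpace.proj i) 2 (by simp)

lemma integrable_eval_mul_eval_stdGaussian (i j : ι) :
    Integrable (fun x : EuclideanSpace ℝ ι ↦ x i * x j) (stdGaussian (EuclideanSpace ℝ ι)) :=
  (memLp_two_eval_stdGaussian i).integrable_mul (memLp_two_eval_stdGaussian j)

lemma integral_eval_mul_eval_stdGaussian [DecidableEq ι] (i j : ι) :
    ∫ x, x i * x j ∂stdGaussian (EuclideanSpace ℝ ι) = if i = j then 1 else 0 := by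
  have hmean (k : ι) : ∫ x, x k ∂stdGaussian (EuclideanSpace ℝ ι) = 0 :=
    integral_strongDual_stdGaussian (EuclideanSpace.proj k)
  have hcov := covariance_eq_sub (memLp_two_eval_stdGaussian i) (memLp_two_eval_stdGaussian j)
  rw [← multivariateGaussian_zero_one, covariance_eval_multivariateGaussian Matrix.PosSemidef.one,
    multivariateGaussian_zero_one, hmean, zero_mul, sub_zero, Matrix.one_apply] at hcov
  exact hcov.symm

variable {V : Type*} [AddCommGroup V] [Module ℝ V]

lemma bilin_sum_smul_eq (B : V →ₗ[ℝ] V →ₗ[ℝ] ℝ) (b : ι → V) (x : ι → ℝ) :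
    B (∑ i, x i • b i) (∑ i, x i • b i) = ∑ i, ∑ j, x i * x j * B (b i) (b j) := by
  simp only [map_sum, map_smul, LinearMap.sum_apply, LinearMap.smul_apply, smul_eq_mul,
    Finset.mul_sum]
  exact Finset.sum_comm.trans <| Finset.sum_congr rfl fun i _ ↦
    Finset.sum_congr rfl fun j _ ↦ by ring

lemma lintegral_bilin_stdGaussian (p : HilbSeminorm V) (b : ι → V) :
    ∫⁻ x, ENNReal.ofReal (p.bilin (∑ i, x i • b i) (∑ i, x i • b i))
      ∂stdGaussian (EuclideanSpace ℝ ι) = ENNReal.ofReal (∑ i, p.bilin (b i) (b i)) := by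
  classical
  have hint (i j : ι) : Integrable (fun x : EuclideanSpace ℝ ι ↦
      x i * x j * p.bilin (b i) (b j)) (stdGaussian (EuclideanSpace ℝ ι)) :=
    (integrable_eval_mul_eval_stdGaussian i j).mul_const _
  rw [← ofReal_integral_eq_lintegral_ofReal]
  · simp_rw [bilin_sum_smul_eq]
    rw [integral_finsetSum _ fun i _ ↦ integrable_finsetSum _ fun j _ ↦ hint i j]
    simp_rw [integral_finsetSum _ fun j _ ↦ hint _ j, integral_mul_const,
      integral_eval_mul_eval_stdGaussian]
    simp
  · simp_rw [bilin_sum_smul_eq]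
    exact integrable_finsetSum _ fun i _ ↦ integrable_finsetSum _ fun j _ ↦ hint i j
  · exact ae_of_all _ fun _ ↦ p.nonneg _

end GaussianBounds

section Statement11

variable {V : Type*} [AddCommGroup V] [Module ℝ V]

/-- The weak topology on the dual of a vector space (for finite-dimensional `V`
this is the canonical topology). -/
instance : TopologicalSpace (Module.Dual ℝ V) :=
  TopologicalSpace.induced (fun (ℓ : Module.Dual ℝ V) (v : V) => ℓ v) inferInstance

instance : MeasurableSpace (Module.Dual ℝ V) := borel (Module.Dual ℝ V)


namespace HilbSeminorm

lemma ofReal_sum_le_trace {ι : Type*} (p q : HilbSeminorm V) (s : Finset ι) (c : ι → V)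
    (hone : ∀ i ∈ s, q.bilin (c i) (c i) = 1)
    (hzero : ∀ i ∈ s, ∀ j ∈ s, i ≠ j → q.bilin (c i) (c j) = 0) :
    ENNReal.ofReal (∑ i ∈ s, p.bilin (c i) (c i)) ≤ p.trace q := by
  classical
  have hinj : Set.InjOn c s := by
    intro i hi j hj hij
    by_contra hne
    have := hzero i hi j hj hne
    rw [← hij, hone i hi] at this
    exact one_ne_zero this
  rw [trace]
  split_ifs
  · rw [← Finset.sum_image (f := fun e ↦ p.bilin e e) hinj]
    refine le_iSup₂_of_le (s.image c) ⟨?_, ?_⟩ (le_of_eq (by congr))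
    · simpa using hone
    · simp only [Finset.mem_image, forall_exists_index, and_imp, forall_apply_eq_imp_iff₂]
      exact fun i hi j hj hne ↦ hzero i hi j hj (ne_of_apply_ne c hne)
  · exact le_top

lemma bilin_eq_zero_of_trace_lt_top {p q : HilbSeminorm V} (htr : p.trace q < ⊤) {v : V}
    (hv : q.bilin v v = 0) : p.bilin v v = 0 := by
  by_contra hne
  rw [trace, if_neg fun h ↦ hne (h v hv)] at htr
  exact lt_irrefl _ htr

lemma sq_toFun (p : HilbSeminorm V) (v : V) : p.toFun v ^ 2 = p.bilin v v :=
  Real.sq_sqrt (p.nonneg v)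

lemma toFun_ne_zero {p : HilbSeminorm V} {v : V} (hv : p.bilin v v ≠ 0) : p.toFun v ≠ 0 := by
  intro h
  rw [← sq_toFun, h] at hv
  simp at hv

lemma toFun_eq_zero {p : HilbSeminorm V} {v : V} (hv : p.bilin v v = 0) : p.toFun v = 0 := by
  simp [toFun, hv]

variable {ι : Type*}

/-- The `q`-normalised vectors of a `q`-orthogonal family, where the vectors in the kernel of `q`
are scaled by `m` instead. -/
noncomputable def scaled (q : HilbSeminorm V) (b : ι → V) (m : ℕ) (i : ι) : V :=
  if q.bilin (b i) (b i) = 0 then (m : ℝ) • b i else (q.toFun (b i))⁻¹ • b i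

lemma monotone_sq_apply_scaled (q : HilbSeminorm V) (b : ι → V) (ℓ : Module.Dual ℝ V) (i : ι) :
    Monotone fun m ↦ ℓ (q.scaled b m i) ^ 2 := by
  intro m n hmn
  by_cases hi : q.bilin (b i) (b i) = 0
  · simp only [scaled, if_pos hi, map_smul, smul_eq_mul, mul_pow]
    gcongr
  · simp [scaled, if_neg hi]

variable [Fintype ι]

lemma abs_apply_le_toFun (q : HilbSeminorm V) (b : Module.Basis ι ℝ V)
    (hb : ∀ i j, i ≠ j → q.bilin (b i) (b j) = 0) (ℓ : Module.Dual ℝ V)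
    (hker : ∀ i, q.bilin (b i) (b i) = 0 → ℓ (b i) = 0)
    (hsum : ∑ i, ((q.toFun (b i))⁻¹ * ℓ (b i)) ^ 2 ≤ 1) (v : V) : |ℓ v| ≤ q.toFun v := by
  classical
  have hℓ : ℓ v = ∑ i, (b.repr v i * q.toFun (b i)) * ((q.toFun (b i))⁻¹ * ℓ (b i)) := by
    conv_lhs => rw [← b.sum_repr v]
    rw [map_sum]
    refine Finset.sum_congr rfl fun i _ ↦ ?_
    by_cases hi : q.bilin (b i) (b i) = 0
    · simp [hker i hi]
    · have := toFun_ne_zero hi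
      rw [map_smul, smul_eq_mul]
      field_simp
  have hq : q.bilin v v = ∑ i, (b.repr v i * q.toFun (b i)) ^ 2 := by
    conv_lhs => rw [← b.sum_repr v]
    rw [bilin_sum_smul_eq]
    refine Finset.sum_congr rfl fun i _ ↦ ?_
    rw [Finset.sum_eq_single i (fun j _ hj ↦ by rw [hb i j hj.symm, mul_zero]) (by simp),
      mul_pow, sq_toFun, sq]
  refine Real.abs_le_sqrt ?_
  rw [hℓ, hq]
  exact (Finset.sum_mul_sq_le_sq_mul_sq _ _ _).trans
    (mul_le_of_le_one_right (Finset.sum_nonneg fun _ _ ↦ sq_nonneg _) hsum)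

lemma ofReal_sum_scaled_le_trace {p q : HilbSeminorm V} (htr : p.trace q < ⊤) {b : ι → V}
    (hb : ∀ i j, i ≠ j → q.bilin (b i) (b j) = 0) (m : ℕ) :
    ENNReal.ofReal (∑ i, p.bilin (q.scaled b m i) (q.scaled b m i)) ≤ p.trace q := by
  classical
  have hsum : ∑ i, p.bilin (q.scaled b m i) (q.scaled b m i) =
      ∑ i with q.bilin (b i) (b i) ≠ 0, p.bilin (q.scaled b m i) (q.scaled b m i) := by
    rw [Finset.sum_filter_of_ne]
    intro i _ hi hqi
    exact hi (by simp [scaled, hqi, bilin_eq_zero_of_trace_lt_top htr hqi])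
  rw [hsum]
  refine ofReal_sum_le_trace p q _ _ (fun i hi ↦ ?_) fun i hi j hj hij ↦ ?_
  · have hqi : q.bilin (b i) (b i) ≠ 0 := by simpa using hi
    have := toFun_ne_zero hqi
    rw [scaled, if_neg hqi]
    simp only [map_smul, LinearMap.smul_apply, smul_eq_mul, ← sq_toFun]
    field_simp
  · have hqi : q.bilin (b i) (b i) ≠ 0 := by simpa using hi
    have hqj : q.bilin (b j) (b j) ≠ 0 := by simpa using hj
    simp [scaled, hqi, hqj, hb i j hij]

lemma abs_apply_le_toFun_of_forall_scaled (q : HilbSeminorm V) (b : Module.Basis ι ℝ V)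
    (hb : ∀ i j, i ≠ j → q.bilin (b i) (b j) = 0) (ℓ : Module.Dual ℝ V)
    (hℓ : ∀ m, ∑ i, ℓ (q.scaled b m i) ^ 2 ≤ 1) (v : V) : |ℓ v| ≤ q.toFun v := by
  refine abs_apply_le_toFun q b hb ℓ (fun i hi ↦ ?_) ?_ v
  · by_contra hne
    obtain ⟨m, hm⟩ := exists_nat_gt |ℓ (b i)|⁻¹
    have hpos : 0 < |ℓ (b i)| := abs_pos.2 hne
    have hone : 1 < m * |ℓ (b i)| := (inv_lt_iff_one_lt_mul₀ hpos).1 hm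
    have hle : ((m : ℝ) * |ℓ (b i)|) ^ 2 ≤ 1 := by
      calc ((m : ℝ) * |ℓ (b i)|) ^ 2 = ℓ (q.scaled b m i) ^ 2 := by
            simp [scaled, hi, mul_pow]
        _ ≤ ∑ j, ℓ (q.scaled b m j) ^ 2 :=
            Finset.single_le_sum (f := fun j ↦ ℓ (q.scaled b m j) ^ 2)
              (fun _ _ ↦ sq_nonneg _) (Finset.mem_univ i)
        _ ≤ 1 := hℓ m
    nlinarith
  · refine le_of_eq_of_le (Finset.sum_congr rfl fun i _ ↦ ?_) (hℓ 0)
    by_cases hi : q.bilin (b i) (b i) = 0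
    · simp [scaled, hi, toFun_eq_zero hi]
    · simp [scaled, hi]

end HilbSeminorm

instance : BorelSpace (Module.Dual ℝ V) := ⟨rfl⟩

@[fun_prop]
lemma measurable_dual_apply (v : V) : Measurable fun ℓ : Module.Dual ℝ V ↦ ℓ v :=
  ((continuous_apply (A := fun _ : V ↦ ℝ) v).comp
    (continuous_induced_dom (f := fun (ℓ : Module.Dual ℝ V) v ↦ ℓ v))).measurable

lemma measure_one_lt_sum_sq_le {ι : Type*} [Fintype ι] (p : HilbSeminorm V)
    (μ : Measure (Module.Dual ℝ V)) [IsProbabilityMeasure μ] {ε δ : ℝ} (hδ : 0 < δ)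
    (h : ∀ v : V, p.toFun v ≤ δ → μ {ℓ : Module.Dual ℝ V | 1 ≤ |ℓ v|} ≤ ENNReal.ofReal ε)
    (b : ι → V) :
    μ {ℓ : Module.Dual ℝ V | 1 < ∑ i, ℓ (b i) ^ 2} ≤
      7 * (ENNReal.ofReal ε + ENNReal.ofReal (δ⁻¹ ^ 2) *
        ENNReal.ofReal (∑ i, p.bilin (b i) (b i))) := by
  set γ := ProbabilityTheory.stdGaussian (EuclideanSpace ℝ ι)
  set S : Set (Module.Dual ℝ V × EuclideanSpace ℝ ι) := {z | 1 ≤ |∑ i, z.2 i * z.1 (b i)|}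
  have hS : MeasurableSet S := by
    refine measurableSet_le measurable_const (continuous_abs.measurable.comp ?_)
    exact Finset.measurable_sum _ fun i _ ↦ Measurable.mul (by fun_prop)
      ((measurable_dual_apply (b i)).comp measurable_fst)
  have hB : MeasurableSet {ℓ : Module.Dual ℝ V | 1 < ∑ i, ℓ (b i) ^ 2} :=
    measurableSet_lt (by fun_prop) (by fun_prop)
  have htail (x : EuclideanSpace ℝ ι) : μ ((fun ℓ ↦ (ℓ, x)) ⁻¹' S) ≤ ENNReal.ofReal ε +
      ENNReal.ofReal (δ⁻¹ ^ 2) *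
        ENNReal.ofReal (p.bilin (∑ i, x i • b i) (∑ i, x i • b i)) := by
    have hset : (fun ℓ ↦ (ℓ, x)) ⁻¹' S = {ℓ : Module.Dual ℝ V | 1 ≤ |ℓ (∑ i, x i • b i)|} := by
      ext ℓ
      simp [S]
    rw [hset]
    rcases le_or_gt (p.toFun (∑ i, x i • b i)) δ with hp | hp
    · exact (h _ hp).trans le_self_add
    · refine prob_le_one.trans (le_add_left ?_)
      rw [← ENNReal.ofReal_mul (by positivity), ENNReal.one_le_ofReal, ← p.sq_toFun, ← mul_pow]
      exact one_le_pow₀ ((one_le_inv_mul₀ hδ).2 hp.le)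
  calc μ {ℓ : Module.Dual ℝ V | 1 < ∑ i, ℓ (b i) ^ 2}
      = ∫⁻ ℓ, {ℓ : Module.Dual ℝ V | 1 < ∑ i, ℓ (b i) ^ 2}.indicator 1 ℓ ∂μ :=
        (lintegral_indicator_one hB).symm
    _ ≤ ∫⁻ ℓ, 7 * γ (Prod.mk ℓ ⁻¹' S) ∂μ :=
        lintegral_mono fun ℓ ↦ Set.indicator_le' (f := 1)
          (fun ℓ hℓ ↦ one_le_seven_mul_stdGaussian (le_of_lt hℓ)) (fun _ _ ↦ zero_le) ℓ
    _ = 7 * (μ.prod γ) S := by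
        rw [lintegral_const_mul _ (measurable_measure_prodMk_left hS), Measure.prod_apply hS]
    _ = 7 * ∫⁻ x, μ ((fun ℓ ↦ (ℓ, x)) ⁻¹' S) ∂γ := by rw [Measure.prod_apply_symm hS]
    _ ≤ 7 * ∫⁻ x, (ENNReal.ofReal ε + ENNReal.ofReal (δ⁻¹ ^ 2) *
          ENNReal.ofReal (p.bilin (∑ i, x i • b i) (∑ i, x i • b i))) ∂γ := by
        gcongr with x
        exact htail x
    _ = _ := by
        rw [lintegral_add_left measurable_const, lintegral_const, measure_univ, mul_one,
          lintegral_const_mul' _ _ ENNReal.ofReal_ne_top, lintegral_bilin_stdGaussian]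

/-- Lemma `lem::fund-lem-Umemura`: support localization for
probability measures on the dual of a finite-dimensional space. -/
theorem statement11 [FiniteDimensional ℝ V]
    (p q : HilbSeminorm V) (htr : p.trace q < ⊤)
    (μ : Measure (Module.Dual ℝ V)) [IsProbabilityMeasure μ]
    (ε δ : ℝ) (hε : 0 < ε) (hδ : 0 < δ)
    (h : ∀ v : V, p.toFun v ≤ δ →
      μ {ℓ : Module.Dual ℝ V | 1 ≤ |ℓ v|} ≤ ENNReal.ofReal ε) :
    ENNReal.ofReal (1 - 7 * (ε + δ⁻¹ ^ 2 * (p.trace q).toReal)) ≤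
      μ {ℓ : Module.Dual ℝ V | ∀ v : V, |ℓ v| ≤ q.toFun v} := by
  let B : LinearMap.BilinForm ℝ V := q.bilin
  obtain ⟨b, hb⟩ := LinearMap.BilinForm.exists_orthogonal_basis (B := B) ⟨q.symm⟩
  have hbq : ∀ i j, i ≠ j → q.bilin (b i) (b j) = 0 := fun i j hij ↦ hb hij
  let A (m : ℕ) : Set (Module.Dual ℝ V) := {ℓ | ∑ i, ℓ (q.scaled b m i) ^ 2 ≤ 1}
  have hA (m : ℕ) : MeasurableSet (A m) := measurableSet_le (by fun_prop) (by fun_prop)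
  have hanti : Antitone A := fun m n hmn ℓ hℓ ↦ (Finset.sum_le_sum fun i _ ↦
    q.monotone_sq_apply_scaled b ℓ i hmn).trans hℓ
  have hbound (m : ℕ) :
      ENNReal.ofReal (1 - 7 * (ε + δ⁻¹ ^ 2 * (p.trace q).toReal)) ≤ μ (A m) := by
    have hcompl : μ (A m)ᶜ ≤
        ENNReal.ofReal (7 * (ε + δ⁻¹ ^ 2 * (p.trace q).toReal)) := by
      have hset : (A m)ᶜ = {ℓ | 1 < ∑ i, ℓ (q.scaled b m i) ^ 2} := by
        ext ℓ
        simp [A]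
      rw [hset, ENNReal.ofReal_mul (by norm_num), ENNReal.ofReal_add hε.le (by positivity),
        ENNReal.ofReal_mul (by positivity), ENNReal.ofReal_toReal htr.ne, ENNReal.ofReal_ofNat]
      refine (measure_one_lt_sum_sq_le p μ hδ h _).trans ?_
      gcongr
      exact HilbSeminorm.ofReal_sum_scaled_le_trace htr hbq m
    rw [ENNReal.ofReal_sub _ (by positivity), ENNReal.ofReal_one, tsub_le_iff_right,
      ← prob_add_prob_compl (μ := μ) (hA m)]
    gcongr
  calc ENNReal.ofReal (1 - 7 * (ε + δ⁻¹ ^ 2 * (p.trace q).toReal)) ≤ μ (⋂ m, A m) :=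
        ge_of_tendsto' (tendsto_measure_iInter_atTop (fun m ↦ (hA m).nullMeasurableSet) hanti
          ⟨0, measure_ne_top _ _⟩) hbound
    _ ≤ _ := measure_mono fun ℓ hℓ ↦
        q.abs_apply_le_toFun_of_forall_scaled b hbq ℓ fun m ↦ Set.mem_iInter.1 hℓ m

end Statement11
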